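/- arXiv:2404.11081 — 2 statements merged into one kernel-verified Lean document; each statement's English description precedes it below -/
import Mathlib

section
/- Under the hypotheses in the context, for every integer k ≥ 1, Σ over k-tuples (α_1,…,α_k) ∈ ι^k of (Σ_{j=1}^{k} f(α_j)) · min(x · exp(T − (1/λ)·Σ_{j=1}^{k} f(α_j)), 1) is at most k · max(x,1)^k · (Σ_{α∈ι} min(exp(T − f(α)/λ), 1))^{k−1} · (Σ_{α∈ι} f(α) · min(exp(T − f(α)/λ), 1)), where all (possibly infinite) sums are taken in the extended nonnegative reals [0,∞] (every summand is nonnegative). -/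
open scoped ENNReal
open Finset

/-- The capped exponential `s ↦ min (exp (T - s)) 1` is submultiplicative on `[0, ∞)`. -/
theorem min_exp_sub_add_le {T s t : ℝ} (hT : 0 ≤ T) (hs : 0 ≤ s) (ht : 0 ≤ t) :
    min (Real.exp (T - (s + t))) 1 ≤ min (Real.exp (T - s)) 1 * min (Real.exp (T - t)) 1 := by
  have h (u : ℝ) : min (Real.exp u) 1 = Real.exp (min u 0) := by
    rw [Real.exp_monotone.map_min, Real.exp_zero]
  rw [h, h, h, ← Real.exp_add, Real.exp_le_exp]
  grind

theorem min_exp_sub_sum_le_prod {κ : Type*} (s : Finset κ) (u : κ → ℝ) (hu : ∀ i, 0 ≤ u i)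
    {T : ℝ} (hT : 0 ≤ T) :
    min (Real.exp (T - ∑ i ∈ s, u i)) 1 ≤ ∏ i ∈ s, min (Real.exp (T - u i)) 1 := by
  classical
  induction s using Finset.induction_on with
  | empty => simp
  | insert i s hi ih =>
    rw [sum_insert hi, prod_insert hi]
    exact (min_exp_sub_add_le hT (hu i) (sum_nonneg fun j _ => hu j)).trans
      (mul_le_mul_of_nonneg_left ih (by positivity))

theorem min_mul_one_le_max_mul_min {x y : ℝ} (hy : 0 ≤ y) :
    min (x * y) 1 ≤ max x 1 * min y 1 := by
  rw [mul_min_of_nonneg _ _ (by positivity), mul_one]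
  exact min_le_min (mul_le_mul_of_nonneg_right (le_max_left _ _) hy) (le_max_right _ _)

namespace ENNReal

theorem tsum_fin_mul_prod_succAbove {ι : Type*} {n : ℕ} (j : Fin (n + 1)) (h : ι → ℝ≥0∞)
    (g : (Fin n → ι) → ℝ≥0∞) :
    ∑' a : Fin (n + 1) → ι, h (a j) * g (fun i => a (j.succAbove i)) =
      (∑' b, h b) * ∑' c, g c := by
  rw [← (Fin.insertNthEquiv (fun _ => ι) j).tsum_eq, ENNReal.tsum_prod']
  simp [Fin.insertNthEquiv, ENNReal.tsum_mul_left, ENNReal.tsum_mul_right]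

theorem tsum_fin_prod_eq_pow {ι : Type*} (g : ι → ℝ≥0∞) (n : ℕ) :
    ∑' a : Fin n → ι, ∏ i, g (a i) = (∑' b, g b) ^ n := by
  induction n with
  | zero => simp
  | succ n ih =>
    simp_rw [Fin.prod_univ_succAbove _ (0 : Fin (n + 1))]
    rw [tsum_fin_mul_prod_succAbove 0 g fun c => ∏ i, g (c i), ih, pow_succ']

theorem tsum_fin_sum_mul_prod {ι : Type*} (h g : ι → ℝ≥0∞) (n : ℕ) :
    ∑' a : Fin (n + 1) → ι, (∑ j, h (a j)) * ∏ i, g (a i) =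
      (n + 1 : ℕ) * (∑' b, g b) ^ n * ∑' b, h b * g b := by
  simp_rw [sum_mul]
  rw [Summable.tsum_finsetSum fun _ _ => ENNReal.summable]
  have key (j : Fin (n + 1)) : ∑' a : Fin (n + 1) → ι, h (a j) * ∏ i, g (a i) =
      (∑' b, h b * g b) * (∑' b, g b) ^ n := by
    simp_rw [Fin.prod_univ_succAbove _ j, ← mul_assoc]
    rw [tsum_fin_mul_prod_succAbove j (fun b => h b * g b) fun c => ∏ i, g (c i),
      tsum_fin_prod_eq_pow]
  simp_rw [key]
  rw [sum_const, card_univ, Fintype.card_fin, nsmul_eq_mul]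
  ring

end ENNReal

/-- (Paper, proof of Lemma `lr_summation`, Eq. (single-sum reduction), `m = 1` case.)
For `f : ι → ℝ` nonnegative, `λ > 0`, `T ≥ 0` and `x > 0`, the sum over `k`-tuples
`(α_1,…,α_k) ∈ ι^k` of `(Σ_j f(α_j)) · min(x·exp(T − (1/λ)Σ_j f(α_j)), 1)` is at most
`k · max(x,1)^k · (Σ_α min(exp(T − f(α)/λ), 1))^{k−1} · (Σ_α f(α)·min(exp(T − f(α)/λ), 1))`,
all sums taken in `[0,∞]`. -/
theorem tuple_weighted_sum_min_exp_le {ι : Type*} (f : ι → ℝ) (hf : ∀ α, 0 ≤ f α)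
    (lam T x : ℝ) (hlam : 0 < lam) (hT : 0 ≤ T) (hx : 0 < x) (k : ℕ) (hk : 1 ≤ k) :
    (∑' a : Fin k → ι,
        ENNReal.ofReal ((∑ j, f (a j)) *
          min (x * Real.exp (T - (1 / lam) * ∑ j, f (a j))) 1))
      ≤ (k : ℝ≥0∞) * ENNReal.ofReal (max x 1) ^ k *
        (∑' α : ι, ENNReal.ofReal (min (Real.exp (T - f α / lam)) 1)) ^ (k - 1) *
        (∑' α : ι, ENNReal.ofReal (f α * min (Real.exp (T - f α / lam)) 1)) := by
  obtain ⟨n, rfl⟩ : ∃ n, k = n + 1 := ⟨k - 1, by lia⟩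
  set F : ι → ℝ≥0∞ := fun b => ENNReal.ofReal (f b)
  set G : ι → ℝ≥0∞ := fun b => ENNReal.ofReal (min (Real.exp (T - f b / lam)) 1)
  have hFG : (fun b => ENNReal.ofReal (f b * min (Real.exp (T - f b / lam)) 1)) =
      fun b => F b * G b := funext fun b => ENNReal.ofReal_mul (hf b)
  have hpt (a : Fin (n + 1) → ι) :
      min (x * Real.exp (T - (1 / lam) * ∑ j, f (a j))) 1 ≤
        max x 1 ^ (n + 1) * ∏ j, min (Real.exp (T - f (a j) / lam)) 1 := by
    refine (min_mul_one_le_max_mul_min (Real.exp_pos _).le).trans ?_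
    have hsum : (1 / lam) * ∑ j, f (a j) = ∑ j, f (a j) / lam := by
      rw [← sum_div]; ring
    rw [hsum]
    exact mul_le_mul (le_self_pow₀ (le_max_right _ _) n.succ_ne_zero)
      (min_exp_sub_sum_le_prod _ _ (fun j => div_nonneg (hf _) hlam.le) hT)
      (by positivity) (by positivity)
  calc _ ≤ ∑' a : Fin (n + 1) → ι, ENNReal.ofReal (max x 1) ^ (n + 1) *
        ((∑ j, F (a j)) * ∏ j, G (a j)) := by
        refine ENNReal.tsum_le_tsum fun a => ?_
        rw [← ENNReal.ofReal_sum_of_nonneg fun j _ => hf (a j),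
          ← ENNReal.ofReal_prod_of_nonneg fun j _ => by positivity,
          ← ENNReal.ofReal_pow (by positivity),
          ← ENNReal.ofReal_mul (sum_nonneg fun j _ => hf (a j)),
          ← ENNReal.ofReal_mul (by positivity), mul_left_comm]
        exact ENNReal.ofReal_le_ofReal
          (mul_le_mul_of_nonneg_left (hpt a) (sum_nonneg fun j _ => hf (a j)))
    _ = _ := by
        rw [ENNReal.tsum_mul_left, ENNReal.tsum_fin_sum_mul_prod, hFG, Nat.add_sub_cancel]
        ring
end

section
/- Under the hypotheses in the context, for every m ∈ {0,1}, every real λ > 0 and every real T, Σ_{α∈ι} dist(S̃_α, S)^m · min(exp(T − dist(S̃_α, S)/λ), 1) ≤ (2^d · Z̃ · |S| / (d−1)!) · Σ_{n=0}^{∞} n^m · (n + d − 1)^{d−1} · min(exp(T − n/λ), 1), where all (possibly infinite) sums are taken in the extended nonnegative reals [0,∞] (every summand is nonnegative). -/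
open scoped ENNReal
open Finset

/-- The `ℓ¹` (Manhattan) distance between two points of the integer lattice `ℤ^d`. -/
def latticeDist {d : ℕ} (x y : Fin d → ℤ) : ℕ := ∑ i, (x i - y i).natAbs

/-- The `ℓ¹` distance between two subsets of `ℤ^d`: the minimum (infimum) of the pairwise
distances. -/
noncomputable def latticeSetDist {d : ℕ} (A B : Set (Fin d → ℤ)) : ℕ :=
  sInf {n : ℕ | ∃ a ∈ A, ∃ b ∈ B, latticeDist a b = n}

theorem ENNReal.tsum_comp_le_of_encard_fiber_le {X Y : Type*} (φ : X → Y) (g : Y → ℝ≥0∞)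
    (c : Y → ℕ) (h : ∀ y, (φ ⁻¹' {y}).encard ≤ c y) :
    ∑' x, g (φ x) ≤ ∑' y, (c y : ℝ≥0∞) * g y := by
  rw [← ENNReal.tsum_fiberwise (fun x ↦ g (φ x)) φ]
  refine ENNReal.tsum_le_tsum fun y ↦ ?_
  have hg : ∀ x : φ ⁻¹' {y}, g (φ x) = g y := fun x ↦ congrArg g x.2
  simp_rw [hg]
  rw [ENNReal.tsum_set_const]
  gcongr
  exact_mod_cast ENat.toENNReal_mono (h y)

theorem encard_latticeDist_eq_le {d : ℕ} (b : Fin d → ℤ) (n : ℕ) :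
    {x : Fin d → ℤ | latticeDist x b = n}.encard ≤ (2 ^ d * (d + n - 1).choose n : ℕ) := by
  let f : (Fin d → ℤ) → (Fin d → Bool) × (Fin d →₀ ℕ) := fun x ↦
    (fun i ↦ decide (b i ≤ x i), Finsupp.equivFunOnFinite.symm fun i ↦ (x i - b i).natAbs)
  let t : Finset ((Fin d → Bool) × (Fin d →₀ ℕ)) := univ ×ˢ univ.finsuppAntidiag n
  have hcard : (t : Set ((Fin d → Bool) × (Fin d →₀ ℕ))).encard =
      (2 ^ d * (d + n - 1).choose n : ℕ) := by
    rw [Set.encard_coe_eq_coe_finsetCard, card_product, card_finsuppAntidiag_nat_eq_choose]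
    simp
  rw [← hcard]
  refine Set.encard_le_encard_of_injOn (f := f) (fun x hx ↦ ?_) fun x _ y _ hxy ↦ ?_
  · simpa [t, f, latticeDist] using hx
  · funext i
    have hsign := congrFun (congrArg Prod.fst hxy) i
    have habs := DFunLike.congr_fun (congrArg Prod.snd hxy) i
    simp only [f, decide_eq_decide, Finsupp.equivFunOnFinite_symm_apply_apply] at hsign habs
    omega

theorem tsum_latticeDist_le {d : ℕ} (b : Fin d → ℤ) (g : ℕ → ℝ≥0∞) :
    ∑' x, g (latticeDist x b) ≤
      ∑' n, ((2 ^ d * (d + n - 1).choose n : ℕ) : ℝ≥0∞) * g n :=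
  ENNReal.tsum_comp_le_of_encard_fiber_le (fun x ↦ latticeDist x b) g
    (fun n ↦ 2 ^ d * (d + n - 1).choose n) (fun n ↦ encard_latticeDist_eq_le b n)

theorem choose_le_add_sub_one_pow_div {d : ℕ} (hd : 1 ≤ d) (n : ℕ) :
    ((d + n - 1).choose n : ℝ) ≤ ((n : ℝ) + d - 1) ^ (d - 1) / (d - 1).factorial := by
  obtain ⟨k, rfl⟩ := Nat.exists_eq_add_of_le' hd
  rw [show k + 1 + n - 1 = k + n by omega, Nat.choose_symm_add.symm, Nat.add_sub_cancel]
  refine (Nat.choose_le_pow_div (α := ℝ) k (k + n)).trans_eq ?_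
  push_cast
  ring

theorem exists_latticeDist_eq_latticeSetDist {d : ℕ} {A B : Set (Fin d → ℤ)}
    (hA : A.Nonempty) (hB : B.Nonempty) :
    ∃ a ∈ A, ∃ b ∈ B, latticeDist a b = latticeSetDist A B := by
  obtain ⟨a, ha⟩ := hA
  obtain ⟨b, hb⟩ := hB
  exact Nat.sInf_mem (s := {n | ∃ a ∈ A, ∃ b ∈ B, latticeDist a b = n}) ⟨_, a, ha, b, hb, rfl⟩

theorem tsum_latticeSetDist_le {d : ℕ} {ι : Type*} {St : ι → Set (Fin d → ℤ)}
    (hStne : ∀ α, (St α).Nonempty) {Z : ℕ}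
    (hZfin : ∀ α, {α' : ι | (St α ∩ St α').Nonempty}.Finite)
    (hZcard : ∀ α, {α' : ι | (St α ∩ St α').Nonempty}.ncard ≤ Z)
    {S : Set (Fin d → ℤ)} (hS : S.Finite) (hSne : S.Nonempty) (g : ℕ → ℝ≥0∞) :
    ∑' α, g (latticeSetDist (St α) S) ≤
      Z * (S.ncard * ∑' n, ((2 ^ d * (d + n - 1).choose n : ℕ) : ℝ≥0∞) * g n) := by
  choose a ha b hb hab using fun α ↦ exists_latticeDist_eq_latticeSetDist (hStne α) hSne
  let φ : ι → S × (Fin d → ℤ) := fun α ↦ (⟨b α, hb α⟩, a α)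
  have hφ : ∀ p, (φ ⁻¹' {p}).encard ≤ (Z : ℕ∞) := by
    intro p
    rcases (φ ⁻¹' {p}).eq_empty_or_nonempty with h | ⟨α, hα⟩
    · simp [h]
    · have hsub : φ ⁻¹' {p} ⊆ {α' | (St α ∩ St α').Nonempty} := fun α' hα' ↦
        have h : a α = a α' := congrArg Prod.snd (hα.trans hα'.symm : φ α = φ α')
        ⟨a α, ha α, h ▸ ha α'⟩
      refine (Set.encard_le_encard hsub).trans ?_
      rw [← (hZfin α).cast_ncard_eq]
      exact_mod_cast hZcard α
  calc ∑' α, g (latticeSetDist (St α) S)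
      = ∑' α, g (latticeDist (φ α).2 (φ α).1) := tsum_congr fun α ↦ by rw [hab α]
    _ ≤ ∑' p : S × (Fin d → ℤ), (Z : ℝ≥0∞) * g (latticeDist p.2 p.1) :=
      ENNReal.tsum_comp_le_of_encard_fiber_le φ (fun p ↦ g (latticeDist p.2 p.1)) (fun _ ↦ Z) hφ
    _ = Z * ∑' (s : S) (x : Fin d → ℤ), g (latticeDist x s) := by
      rw [ENNReal.tsum_mul_left, ENNReal.tsum_prod']
    _ ≤ Z * ∑' _ : S, ∑' n, ((2 ^ d * (d + n - 1).choose n : ℕ) : ℝ≥0∞) * g n := by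
      gcongr with s
      exact tsum_latticeDist_le s.1 g
    _ = _ := by
      rw [ENNReal.tsum_set_const, ← hS.cast_ncard_eq, ENat.toENNReal_coe]

/-- (Paper, Eq. in the proof of Lemma `lr_summation`.)  Let `(S̃_α)_{α∈ι}` be a family of finite
nonempty subsets of `ℤ^d`, each intersecting at most `Z̃` members of the family, and let
`S ⊆ ℤ^d` be finite and nonempty.  Then for `m ∈ {0,1}`, `λ > 0` and any real `T`,
`Σ_α dist(S̃_α,S)^m · min(exp(T − dist(S̃_α,S)/λ), 1)
  ≤ (2^d Z̃ |S| / (d−1)!) · Σ_{n=0}^∞ n^m (n+d−1)^{d−1} min(exp(T − n/λ), 1)`,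
all sums taken in `[0,∞]`. -/
theorem sum_dist_min_exp_le (d : ℕ) (hd : 1 ≤ d) {ι : Type*}
    (St : ι → Set (Fin d → ℤ))
    (hStfin : ∀ α, (St α).Finite) (hStne : ∀ α, (St α).Nonempty)
    (Z : ℕ)
    (hZfin : ∀ α, {α' : ι | (St α ∩ St α').Nonempty}.Finite)
    (hZcard : ∀ α, {α' : ι | (St α ∩ St α').Nonempty}.ncard ≤ Z)
    (S : Set (Fin d → ℤ)) (hS : S.Finite) (hSne : S.Nonempty)
    (m : ℕ) (hm : m ≤ 1) (lam T : ℝ) (hlam : 0 < lam) :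
    (∑' α : ι,
        ENNReal.ofReal (((latticeSetDist (St α) S : ℝ)) ^ m *
          min (Real.exp (T - (latticeSetDist (St α) S : ℝ) / lam)) 1))
      ≤ ENNReal.ofReal (2 ^ d * (Z : ℝ) * (S.ncard : ℝ) / (Nat.factorial (d - 1) : ℝ)) *
        (∑' n : ℕ,
          ENNReal.ofReal ((n : ℝ) ^ m * ((n : ℝ) + (d : ℝ) - 1) ^ (d - 1) *
            min (Real.exp (T - (n : ℝ) / lam)) 1)) := by
  refine (tsum_latticeSetDist_le hStne hZfin hZcard hS hSne fun n ↦
    ENNReal.ofReal ((n : ℝ) ^ m * min (Real.exp (T - (n : ℝ) / lam)) 1)).trans ?_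
  simp_rw [← ENNReal.tsum_mul_left]
  refine ENNReal.tsum_le_tsum fun n ↦ ?_
  rw [← ENNReal.ofReal_natCast, ← ENNReal.ofReal_natCast S.ncard, ← ENNReal.ofReal_natCast,
    ← ENNReal.ofReal_mul (by positivity), ← ENNReal.ofReal_mul (by positivity),
    ← ENNReal.ofReal_mul (by positivity), ← ENNReal.ofReal_mul (by positivity)]
  refine ENNReal.ofReal_le_ofReal ?_
  have hmin : 0 ≤ min (Real.exp (T - (n : ℝ) / lam)) 1 := by positivity
  calc (Z : ℝ) * (S.ncard * (((2 ^ d * (d + n - 1).choose n : ℕ) : ℝ) *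
        ((n : ℝ) ^ m * min (Real.exp (T - (n : ℝ) / lam)) 1)))
      = Z * S.ncard * 2 ^ d * ((n : ℝ) ^ m * min (Real.exp (T - (n : ℝ) / lam)) 1) *
          (d + n - 1).choose n := by push_cast; ring
    _ ≤ Z * S.ncard * 2 ^ d * ((n : ℝ) ^ m * min (Real.exp (T - (n : ℝ) / lam)) 1) *
          (((n : ℝ) + d - 1) ^ (d - 1) / (d - 1).factorial) := by
      gcongr
      exact choose_le_add_sub_one_pow_div hd n
    _ = _ := by ring
end
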